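/- For 1 ≤ i ≤ n and natural numbers j, k ≥ 0, the Steenrod operation P^{p^k} acts on the p^j-th power of the Dickson invariant d_{n,i} by: P^{p^k}(d_{n,i}^{p^j}) = d_{n,i+1}^{p^j} if k = n + j - i - 1 and i < n; P^{p^k}(d_{n,i}^{p^j}) = -d_{n,i}^{p^j} · d_{n,1}^{p^j} if k = j + n - 1; and P^{p^k}(d_{n,i}^{p^j}) = 0 in all other cases. -/

import Mathlib

open MvPolynomial Matrix

/-- The algebra automorphism of `F_p[y_1,...,y_n]` induced by `g ∈ GL_n(F_p)`
(linear substitution of the variables: `y_i ↦ ∑_j g_{j i} y_j`). -/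
noncomputable def glAct (p n : ℕ) (g : GL (Fin n) (ZMod p)) :
    MvPolynomial (Fin n) (ZMod p) →ₐ[ZMod p] MvPolynomial (Fin n) (ZMod p) :=
  aeval fun i => ∑ j, C ((g : Matrix (Fin n) (Fin n) (ZMod p)) j i) * X j

/-- The total Steenrod operation `P_t`, the algebra homomorphism with
`P_t(y_i) = y_i + y_i^p t`. -/
noncomputable def Pt (p n : ℕ) :
    MvPolynomial (Fin n) (ZMod p) →ₐ[ZMod p] Polynomial (MvPolynomial (Fin n) (ZMod p)) :=
  aeval fun i => Polynomial.C (X i) + Polynomial.C (X i ^ p) * Polynomial.X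

/-- The Steenrod operation `P^k`: the coefficient of `t^k` in `P_t(f)`. -/
noncomputable def steenrod (p n k : ℕ) (f : MvPolynomial (Fin n) (ZMod p)) :
    MvPolynomial (Fin n) (ZMod p) :=
  (Pt p n f).coeff k

/-- The Dickson invariant `d_{n,i}`, defined from the identity
`∏_{v ∈ F_p^n} (X + v·y) = ∑_{i=0}^n (-1)^i d_{n,i} X^{p^{n-i}}`. -/
noncomputable def dickson (p n i : ℕ) [NeZero p] : MvPolynomial (Fin n) (ZMod p) :=
  (-1) ^ i *
    (∏ v : Fin n → ZMod p,
      (Polynomial.X + Polynomial.C (∑ j, C (v j) * X j))).coeff (p ^ (n - i))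

/-- The iterated Steenrod operation `P(c,j) = P^{p^{c-j+1}} ∘ ⋯ ∘ P^{p^{c-1}} ∘ P^{p^c}`
(`P^{p^c}` applied first). -/
noncomputable def Pcj (p n c : ℕ) : ℕ → MvPolynomial (Fin n) (ZMod p) → MvPolynomial (Fin n) (ZMod p)
  | 0 => id
  | j + 1 => fun f => steenrod p n (p ^ (c + 1 - (j + 1))) (Pcj p n c j f)

/-- Apply the composite `P^{p^{s_1}} ∘ P^{p^{s_2}} ∘ ⋯ ∘ P^{p^{s_r}}` (last entry applied first). -/
noncomputable def steenrodList (p n : ℕ) :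
    List ℕ → MvPolynomial (Fin n) (ZMod p) → MvPolynomial (Fin n) (ZMod p)
  | [] => id
  | s :: rest => fun f => steenrod p n (p ^ s) (steenrodList p n rest f)

/-- The product `∏ (X + ∑ v_j ℓ_j)` over all `v ∈ F_p^n`, for elements `ℓ_1, ..., ℓ_n` of an
`F_p`-algebra. -/
noncomputable def linearFormProd (p : ℕ) [Fact p.Prime] {n : ℕ} {R : Type*} [CommRing R]
    [Algebra (ZMod p) R] (l : Fin n → R) : Polynomial R :=
  ∏ v : Fin n → ZMod p, (Polynomial.X + Polynomial.C (∑ j, v j • l j))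

theorem Polynomial.coeff_sum_C_mul_X_pow_pow {R : Type*} [Semiring R] {p : ℕ} (hp : 1 < p)
    (a : ℕ → R) (N k : ℕ) :
    (∑ m ∈ Finset.range N, Polynomial.C (a m) * Polynomial.X ^ p ^ m).coeff (p ^ k) =
      if k < N then a k else 0 := by
  simp [Polynomial.finsetSum_coeff, Polynomial.coeff_C_mul, Polynomial.coeff_X_pow,
    (Nat.pow_right_injective hp).eq_iff]

section

variable {p : ℕ} [Fact p.Prime] {n : ℕ} {R S : Type*} [CommRing R] [Algebra (ZMod p) R]
  [CommRing S] [Algebra (ZMod p) S]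

theorem map_linearFormProd (φ : R →ₐ[ZMod p] S) (l : Fin n → R) :
    (linearFormProd p l).map (φ : R →+* S) = linearFormProd p (fun i => φ (l i)) := by
  simp only [linearFormProd, Polynomial.map_prod, Polynomial.map_add, Polynomial.map_X,
    Polynomial.map_C, RingHom.coe_coe]
  simp only [map_sum, map_smul]

theorem ZMod.prod_X_sub_C :
    ∏ c : ZMod p, (Polynomial.X - Polynomial.C c) =
      Polynomial.X ^ p - (Polynomial.X : Polynomial (ZMod p)) := by
  have hp1 : 1 < p := (Fact.out : p.Prime).one_lt
  have hr := FiniteField.roots_X_pow_card_sub_X (ZMod p)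
  rw [ZMod.card] at hr
  have := Polynomial.prod_multiset_X_sub_C_of_monic_of_roots_card_eq
    (p := (Polynomial.X ^ p - Polynomial.X : Polynomial (ZMod p)))
    (Polynomial.monic_X_pow_sub (by simpa using hp1)) (by
      rw [hr, FiniteField.X_pow_card_sub_X_natDegree_eq _ hp1]
      simp [ZMod.card])
  rwa [hr] at this

theorem ZMod.prod_add_smul_of_field {K : Type*} [Field K] [Algebra (ZMod p) K] (x y : K) :
    ∏ c : ZMod p, (x + c • y) = x ^ p - y ^ (p - 1) * x := by
  have hp1 : 1 < p := (Fact.out : p.Prime).one_lt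
  rcases eq_or_ne y 0 with rfl | hy
  · simp [ZMod.card, Nat.sub_ne_zero_of_lt hp1]
  have h := congrArg (Polynomial.aeval (x / y)) (ZMod.prod_X_sub_C (p := p))
  simp only [map_prod, map_sub, Polynomial.aeval_X, Polynomial.aeval_C, map_pow] at h
  rw [← Equiv.prod_comp (Equiv.neg (ZMod p))] at h
  simp only [Equiv.neg_apply, map_neg, sub_neg_eq_add] at h
  have hc : ∀ c : ZMod p, x + c • y = y * (x / y + algebraMap (ZMod p) K c) := by
    intro c
    rw [Algebra.smul_def]
    field_simp
  rw [Finset.prod_congr rfl (fun c _ => hc c), Finset.prod_mul_distrib, h]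
  have hy' : y ^ p = y ^ (p - 1) * y := (pow_sub_one_mul (by omega) y).symm
  simp only [Finset.prod_const, Finset.card_univ, ZMod.card]
  rw [mul_sub, div_pow, mul_div_cancel₀ _ (pow_ne_zero _ hy), hy', mul_assoc, mul_div_cancel₀ _ hy]

theorem ZMod.prod_add_smul [IsDomain R] (x y : R) :
    ∏ c : ZMod p, (x + c • y) = x ^ p - y ^ (p - 1) * x := by
  apply IsFractionRing.injective R (FractionRing R)
  have h : ∀ c : ZMod p, algebraMap R (FractionRing R) (x + c • y) =
      algebraMap R (FractionRing R) x + c • algebraMap R (FractionRing R) y := fun c => by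
    rw [map_add, Algebra.smul_def, Algebra.smul_def, map_mul, ← IsScalarTower.algebraMap_apply]
  rw [map_prod, Finset.prod_congr rfl fun c _ => h c, ZMod.prod_add_smul_of_field]
  simp

theorem sum_smul_pow_char (v : Fin n → ZMod p) (l : Fin n → R) :
    (∑ j, v j • l j) ^ p = ∑ j, v j • l j ^ p := by
  rcases subsingleton_or_nontrivial R with h | h
  · exact Subsingleton.elim _ _
  have : CharP R p := charP_of_injective_algebraMap (algebraMap (ZMod p) R).injective p
  simp [sum_pow_char, smul_pow]

theorem linearFormProd_cons (y : R) (l : Fin n → R) :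
    linearFormProd p (Fin.cons y l : Fin (n + 1) → R) =
      ∏ c : ZMod p, (linearFormProd p l).comp (Polynomial.X + Polynomial.C (c • y)) := by
  unfold linearFormProd
  rw [← Equiv.prod_comp (Fin.consEquiv fun _ => ZMod p), Fintype.prod_prod_type]
  refine Finset.prod_congr rfl fun c _ => ?_
  rw [Polynomial.prod_comp]
  refine Finset.prod_congr rfl fun v _ => ?_
  simp [Fin.sum_univ_succ, Fin.consEquiv, add_assoc]

theorem comp_add_C_smul_of_eq_sum {g : Polynomial R} {a : ℕ → R} {N : ℕ}
    (hg : g = ∑ m ∈ Finset.range N, Polynomial.C (a m) * Polynomial.X ^ p ^ m)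
    (c : ZMod p) (y : R) :
    g.comp (Polynomial.X + Polynomial.C (c • y)) = g + c • Polynomial.C (g.eval y) := by
  rcases subsingleton_or_nontrivial R with h | h
  · exact Subsingleton.elim _ _
  have : CharP R p := charP_of_injective_algebraMap (algebraMap (ZMod p) R).injective p
  have hc : ∀ m : ℕ, c ^ p ^ m = c := fun m => ZMod.pow_card_pow c
  subst hg
  simp only [Polynomial.sum_comp, Polynomial.mul_comp, Polynomial.C_comp, Polynomial.X_pow_comp,
    add_pow_char_pow, Polynomial.eval_finsetSum, Polynomial.eval_mul, Polynomial.eval_C,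
    Polynomial.eval_pow, Polynomial.eval_X, map_sum, map_mul, map_pow, Finset.smul_sum,
    ← Finset.sum_add_distrib, mul_add]
  refine Finset.sum_congr rfl fun m _ => ?_
  rw [← Polynomial.C_pow, smul_pow, hc, ← Polynomial.smul_C, mul_smul_comm, Polynomial.C_pow]

theorem exists_linearFormProd_eq_sum [IsDomain R] (l : Fin n → R) :
    ∃ a : ℕ → R, a n = 1 ∧ linearFormProd p l =
      ∑ m ∈ Finset.range (n + 1), Polynomial.C (a m) * Polynomial.X ^ p ^ m := by
  induction n with
  | zero => exact ⟨fun _ => 1, rfl, by simp [linearFormProd]⟩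
  | succ n ih =>
    obtain ⟨a, ha, hsum⟩ := ih (Fin.tail l)
    have : CharP R p := charP_of_injective_algebraMap (algebraMap (ZMod p) R).injective p
    set z := (linearFormProd p (Fin.tail l)).eval (l 0) with hz
    refine ⟨fun m => (if m = 0 then 0 else a (m - 1) ^ p) -
      z ^ (p - 1) * (if m < n + 1 then a m else 0), by simp [ha], ?_⟩
    rw [← Fin.cons_self_tail l, linearFormProd_cons]
    simp_rw [comp_add_C_smul_of_eq_sum hsum]
    rw [ZMod.prod_add_smul]
    simp only [Polynomial.C_sub, sub_mul, Finset.sum_sub_distrib]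
    rw [← hz]
    congr 1
    · rw [hsum, sum_pow_char, Finset.sum_range_succ' _ (n + 1)]
      simp [mul_pow, pow_succ, pow_mul]
    · rw [Finset.sum_range_succ, hsum, Finset.mul_sum]
      simp only [lt_irrefl, if_false, mul_zero, map_zero, zero_mul, add_zero]
      refine Finset.sum_congr rfl fun m hm => ?_
      rw [if_pos (Finset.mem_range.1 hm)]
      simp [mul_assoc]

theorem coeff_linearFormProd_top [IsDomain R] (l : Fin n → R) :
    (linearFormProd p l).coeff (p ^ n) = 1 := by
  obtain ⟨a, ha, hsum⟩ := exists_linearFormProd_eq_sum (p := p) l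
  rw [hsum, Polynomial.coeff_sum_C_mul_X_pow_pow (Fact.out : p.Prime).one_lt]
  simp [ha]

theorem linearFormProd_eq_sum [IsDomain R] (l : Fin n → R) :
    linearFormProd p l = ∑ m ∈ Finset.range (n + 1),
      Polynomial.C ((linearFormProd p l).coeff (p ^ m)) * Polynomial.X ^ p ^ m := by
  obtain ⟨a, ha, hsum⟩ := exists_linearFormProd_eq_sum (p := p) l
  nth_rewrite 1 [hsum]
  refine Finset.sum_congr rfl fun m hm => ?_
  rw [hsum, Polynomial.coeff_sum_C_mul_X_pow_pow (Fact.out : p.Prime).one_lt,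
    if_pos (Finset.mem_range.1 hm)]

theorem monic_linearFormProd (l : Fin n → R) : (linearFormProd p l).Monic :=
  Polynomial.monic_prod_of_monic _ _ fun _ _ => Polynomial.monic_X_add_C _

theorem natDegree_linearFormProd [IsDomain R] (l : Fin n → R) :
    (linearFormProd p l).natDegree = p ^ n := by
  rw [linearFormProd, Polynomial.natDegree_prod_of_monic _ _
    fun _ _ => Polynomial.monic_X_add_C _]
  simp only [Polynomial.natDegree_X_add_C]
  simp

theorem linearFormProd_comp_eq_sum [IsDomain R] (l : Fin n → R) (t : R) :
    (linearFormProd p l).comp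
        (Polynomial.X + Polynomial.C t * Polynomial.X ^ p) =
      ∑ m ∈ Finset.range (n + 1),
          Polynomial.C ((linearFormProd p l).coeff (p ^ m)) * Polynomial.X ^ p ^ m +
        ∑ m ∈ Finset.range (n + 1),
          Polynomial.C (t ^ p ^ m * (linearFormProd p l).coeff (p ^ m)) *
            Polynomial.X ^ p ^ (m + 1) := by
  have : CharP R p := charP_of_injective_algebraMap (algebraMap (ZMod p) R).injective p
  nth_rewrite 1 [linearFormProd_eq_sum l]
  simp only [Polynomial.sum_comp, Polynomial.mul_comp, Polynomial.C_comp, Polynomial.X_pow_comp,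
    add_pow_char_pow, ← Finset.sum_add_distrib, mul_add, mul_pow, Polynomial.C_mul,
    Polynomial.C_pow]
  refine Finset.sum_congr rfl fun m _ => ?_
  ring

theorem linearFormProd_pow_eq_sum [IsDomain R] (l : Fin n → R) :
    linearFormProd p l ^ p = ∑ m ∈ Finset.range (n + 1),
      Polynomial.C ((linearFormProd p l).coeff (p ^ m) ^ p) * Polynomial.X ^ p ^ (m + 1) := by
  have : CharP R p := charP_of_injective_algebraMap (algebraMap (ZMod p) R).injective p
  nth_rewrite 1 [linearFormProd_eq_sum l]
  rw [sum_pow_char]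
  simp [mul_pow, pow_succ, pow_mul]

theorem linearFormProd_comp [IsDomain R] (l : Fin n → R) (t : R) :
    (linearFormProd p (fun i => l i + t * l i ^ p)).comp
        (Polynomial.X + Polynomial.C t * Polynomial.X ^ p) =
      Polynomial.C (t ^ p ^ n) * linearFormProd p l ^ p +
        Polynomial.C (∏ v : Fin n → ZMod p, (1 + t * (∑ j, v j • l j) ^ (p - 1))) *
          linearFormProd p l := by
  have : CharP R p := charP_of_injective_algebraMap (algebraMap (ZMod p) R).injective p
  have hp : 1 < p := (Fact.out : p.Prime).one_lt
  set f := linearFormProd p l with hf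
  set g := linearFormProd p (fun i => l i + t * l i ^ p) with hg
  set H := ∏ v : Fin n → ZMod p, (1 + t * (∑ j, v j • l j) ^ (p - 1)) with hH
  let q : Polynomial R := ∏ v : Fin n → ZMod p,
    (1 + Polynomial.C t * (Polynomial.X + Polynomial.C (∑ j, v j • l j)) ^ (p - 1))
  have hfac : g.comp (Polynomial.X + Polynomial.C t * Polynomial.X ^ p) = f * q := by
    rw [hg, hf, linearFormProd, linearFormProd, Polynomial.prod_comp, ← Finset.prod_mul_distrib]
    refine Finset.prod_congr rfl fun v _ => ?_
    have h1 : ∑ j, v j • (l j + t * l j ^ p) = ∑ j, v j • l j + t * (∑ j, v j • l j) ^ p := by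
      rw [sum_smul_pow_char, Finset.mul_sum, ← Finset.sum_add_distrib]
      exact Finset.sum_congr rfl fun j _ => by rw [smul_add, mul_smul_comm]
    rw [h1]
    set L := ∑ j, v j • l j
    have h2 := add_pow_char Polynomial.X (Polynomial.C L) p
    have h3 : (Polynomial.X + Polynomial.C L) ^ p =
        (Polynomial.X + Polynomial.C L) * (Polynomial.X + Polynomial.C L) ^ (p - 1) :=
      (mul_pow_sub_one (by omega) _).symm
    simp only [Polynomial.add_comp, Polynomial.X_comp, Polynomial.C_comp]
    simp only [Polynomial.C_add, Polynomial.C_mul, Polynomial.C_pow]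
    linear_combination Polynomial.C t * h3 - Polynomial.C t * h2
  set c := q - Polynomial.C (t ^ p ^ n) * f ^ (p - 1) - Polynomial.C H with hc
  have hfp : f ^ p = f * f ^ (p - 1) := (mul_pow_sub_one (by omega) _).symm
  have hE : g.comp (Polynomial.X + Polynomial.C t * Polynomial.X ^ p) -
      Polynomial.C (t ^ p ^ n) * f ^ p - Polynomial.C H * f = f * c := by
    rw [hfac, hfp, hc]; ring
  have hdeg : (f * c).natDegree ≤ p ^ n := by
    have hm : ∀ (b : R) (m : ℕ), m ≤ n →
        (Polynomial.C b * Polynomial.X ^ p ^ m).natDegree ≤ p ^ n := fun b m h =>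
      (Polynomial.natDegree_C_mul_X_pow_le _ _).trans (Nat.pow_le_pow_right (by omega) h)
    have hEs : f * c =
        ∑ m ∈ Finset.range (n + 1), Polynomial.C (g.coeff (p ^ m)) * Polynomial.X ^ p ^ m +
        ∑ m ∈ Finset.range n, Polynomial.C (t ^ p ^ m * g.coeff (p ^ m) -
          t ^ p ^ n * f.coeff (p ^ m) ^ p) * Polynomial.X ^ p ^ (m + 1) -
        Polynomial.C H * f := by
      rw [← hE, hg, linearFormProd_comp_eq_sum, hf, linearFormProd_pow_eq_sum,
        Finset.mul_sum, add_sub_assoc (∑ m ∈ Finset.range (n + 1), _), ← Finset.sum_sub_distrib,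
        Finset.sum_range_succ (n := n) (f := fun m => _ - _),
        coeff_linearFormProd_top, coeff_linearFormProd_top]
      simp [sub_mul, mul_assoc]
    rw [hEs]
    refine Polynomial.natDegree_sub_le_of_le (Polynomial.natDegree_add_le_of_degree_le
      (Polynomial.natDegree_sum_le_of_forall_le _ _ fun m h => hm _ _ ?_)
      (Polynomial.natDegree_sum_le_of_forall_le _ _ fun m h => hm _ _ ?_))
      ((Polynomial.natDegree_C_mul_le _ _).trans (natDegree_linearFormProd l).le) |>.trans
      (max_self _).le
    · exact Nat.lt_succ_iff.1 (Finset.mem_range.1 h)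
    · exact Finset.mem_range.1 h
  have hc0 : c.natDegree = 0 := by
    rcases eq_or_ne c 0 with h | h
    · simp [h]
    rw [(monic_linearFormProd l).natDegree_mul' h, natDegree_linearFormProd] at hdeg
    omega
  have hce : c.eval 0 = 0 := by
    have hf0 : f.eval 0 = 0 := by
      rw [hf, linearFormProd, Polynomial.eval_prod]
      exact Finset.prod_eq_zero (Finset.mem_univ 0) (by simp)
    have hq : q.eval 0 = H := by
      simp [q, hH, Polynomial.eval_prod, -map_sum]
    simp [hc, hf0, hq, Nat.sub_ne_zero_of_lt hp]
  have hcz : c = 0 := by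
    rw [Polynomial.eq_C_of_natDegree_eq_zero hc0, Polynomial.coeff_zero_eq_eval_zero, hce, map_zero]
  rw [hcz, mul_zero] at hE
  linear_combination hE

theorem coeff_linearFormProd_recursion [IsDomain R] (l : Fin n → R) (t : R) (m : ℕ) (hm : m < n) :
    (linearFormProd p (fun i => l i + t * l i ^ p)).coeff (p ^ (m + 1)) +
        t ^ p ^ m * (linearFormProd p (fun i => l i + t * l i ^ p)).coeff (p ^ m) =
      t ^ p ^ n * (linearFormProd p l).coeff (p ^ m) ^ p +
        (∏ v : Fin n → ZMod p, (1 + t * (∑ j, v j • l j) ^ (p - 1))) *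
          (linearFormProd p l).coeff (p ^ (m + 1)) := by
  have hp : 1 < p := (Fact.out : p.Prime).one_lt
  have h := congrArg (fun f => Polynomial.coeff f (p ^ (m + 1))) (linearFormProd_comp (p := p) l t)
  rw [linearFormProd_comp_eq_sum, linearFormProd_pow_eq_sum] at h
  simp only [Polynomial.coeff_add, Polynomial.finsetSum_coeff, Polynomial.coeff_C_mul,
    Polynomial.coeff_X_pow, (Nat.pow_right_injective hp).eq_iff] at h
  simpa [hm, hm.trans (Nat.lt_succ_self n)] using h

theorem coeff_linearFormProd_one [IsDomain R] (l : Fin n → R) (t : R) :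
    (linearFormProd p (fun i => l i + t * l i ^ p)).coeff 1 =
        (∏ v : Fin n → ZMod p, (1 + t * (∑ j, v j • l j) ^ (p - 1))) *
          (linearFormProd p l).coeff 1 := by
  have hp : 1 < p := (Fact.out : p.Prime).one_lt
  have h := congrArg (fun f => Polynomial.coeff f (p ^ 0)) (linearFormProd_comp (p := p) l t)
  rw [linearFormProd_comp_eq_sum, linearFormProd_pow_eq_sum] at h
  simp only [Polynomial.coeff_add, Polynomial.finsetSum_coeff, Polynomial.coeff_C_mul,
    Polynomial.coeff_X_pow, (Nat.pow_right_injective hp).eq_iff] at h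
  simpa using h

end

theorem coeff_prime_pow_of_recursion {S : Type*} [CommRing S] {p N : ℕ} (hp : 1 < p)
    {a b : ℕ → S} {A : ℕ → Polynomial S} {H : Polynomial S}
    (h0 : A 0 = H * Polynomial.C (a 0))
    (hrec : ∀ m ≤ N, A (m + 1) + Polynomial.X ^ p ^ m * A m =
      Polynomial.X ^ p ^ (N + 1) * Polynomial.C (b m) + H * Polynomial.C (a (m + 1)))
    (ha : a (N + 1) = 1) (hA : A (N + 1) = 1) (hH : H.natDegree ≤ p ^ (N + 1))
    {m : ℕ} (hm : m ≤ N) (k : ℕ) :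
    (A m).coeff (p ^ k) =
      if k + 1 = m then -a (m - 1) else if k = N then a m * a N else 0 := by
  have hp0 : ∀ m, 0 < p ^ m := fun m => Nat.pow_pos (by omega)
  have hlt : ∀ {u v : ℕ}, u < v → p ^ u < p ^ v := fun h => Nat.pow_lt_pow_right hp h
  have hle : ∀ {u v : ℕ}, u ≤ v → p ^ u ≤ p ^ v := fun h => Nat.pow_le_pow_right (by omega) h
  have htwo : ∀ u, 2 * p ^ u ≤ p ^ (u + 1) := fun u => by
    rw [pow_succ, mul_comm]; exact Nat.mul_le_mul_left _ hp
  have hc : ∀ m ≤ N, ∀ e, (A (m + 1)).coeff e +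
      (if p ^ m ≤ e then (A m).coeff (e - p ^ m) else 0) =
      (if e = p ^ (N + 1) then b m else 0) + H.coeff e * a (m + 1) := by
    intro m hm e
    have h := congrArg (fun f => Polynomial.coeff f e) (hrec m hm)
    simpa only [Polynomial.coeff_add, Polynomial.coeff_X_pow_mul', Polynomial.coeff_mul_C,
      Polynomial.coeff_X_pow, ite_mul, one_mul, zero_mul] using h
  have high : ∀ m ≤ N + 1, ∀ e, p ^ (N + 1) ≤ e → (A m).coeff e = 0 := by
    intro m hm
    induction hm using Nat.decreasingInduction with
    | self =>
      intro e he
      have := hp0 (N + 1)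
      rw [hA, Polynomial.coeff_one, if_neg (by omega)]
    | of_succ m hm ih =>
      intro e he
      have h := hc m (by omega) (e + p ^ m)
      have := hp0 m
      rw [ih _ (by omega), if_pos (by omega), if_neg (by omega),
        Polynomial.coeff_eq_zero_of_natDegree_lt (p := H) (by omega)] at h
      simpa using h
  have Hlow : ∀ e < p ^ N, H.coeff e = if e = 0 then 1 else 0 := by
    intro e he
    have h := hc N le_rfl e
    have := hlt (Nat.lt_succ_self N)
    rw [if_neg (by omega), if_neg (by simp only [Nat.succ_eq_add_one] at this; omega), hA, ha,
      Polynomial.coeff_one] at h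
    simpa using h.symm
  have A0 : ∀ m ≤ N, (A m).coeff 0 = a m := by
    intro m hm
    have hH0 := Hlow 0 (hp0 N)
    cases m with
    | zero => simp [h0, hH0]
    | succ m =>
      have h := hc m (by omega) 0
      have := hp0 m
      have := hp0 (N + 1)
      rw [if_neg (by omega), if_neg (by omega), hH0] at h
      simpa using h
  have HN : H.coeff (p ^ N) = a N := by
    have h := hc N le_rfl (p ^ N)
    have := hp0 N
    rw [if_pos le_rfl, if_neg (hlt (Nat.lt_succ_self N)).ne, hA, ha, Nat.sub_self, A0 N le_rfl,
      Polynomial.coeff_one, if_neg (by omega)] at h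
    simpa using h.symm
  have mid : ∀ m ≤ N, ∀ e, p ^ m ≤ e → e < p ^ N → (A m).coeff e = 0 := by
    intro m
    induction m with
    | zero =>
      intro _ e he he'
      rw [h0, Polynomial.coeff_mul_C, Hlow e he', if_neg (by simp at he; omega), zero_mul]
    | succ m ih =>
      intro hm e he he'
      have h := hc m (by omega) e
      have := htwo m
      have := hp0 m
      have := hlt (Nat.lt_succ_self N)
      rw [if_pos (by omega), if_neg (by simp only [Nat.succ_eq_add_one] at this; omega),
        ih (by omega) _ (by omega) (by omega), Hlow e he', if_neg (by omega)] at h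
      simpa using h
  rcases lt_or_ge N k with hk | hk
  · rw [high m (by omega) _ (hle hk), if_neg (by omega), if_neg (by omega)]
  have HP : H.coeff (p ^ k) = if k = N then a N else 0 := by
    split_ifs with h
    · rw [h, HN]
    · rw [Hlow _ (hlt (by omega)), if_neg (hp0 k).ne']
  cases m with
  | zero => simp [h0, HP, mul_comm]
  | succ m =>
    have h := hc m (by omega) (p ^ k)
    rw [if_neg (hlt (by omega)).ne, HP] at h
    rcases lt_trichotomy k m with hkm | rfl | hkm
    · rw [if_neg (hlt hkm).not_ge] at h
      rw [if_neg (by omega), if_neg (by omega)]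
      rw [if_neg (by omega)] at h
      simpa using h
    · rw [if_pos le_rfl, Nat.sub_self, A0 k (by omega), if_neg (by omega)] at h
      simpa using eq_neg_of_add_eq_zero_left (by simpa using h)
    · have h1 := htwo m
      have h2 := hle (show m + 1 ≤ k from hkm)
      have h3 := hle hk
      have h4 := hp0 m
      rw [if_pos (by omega), mid m (by omega) _ (by omega) (by omega)] at h
      rw [if_neg (by omega)]
      simpa [mul_comm] using h

section

variable {p : ℕ} [Fact p.Prime] {n : ℕ}

theorem dickson_eq_coeff_linearFormProd (i : ℕ) :
    dickson p n i = (-1) ^ i *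
      (linearFormProd p (X : Fin n → MvPolynomial (Fin n) (ZMod p))).coeff (p ^ (n - i)) := by
  simp only [dickson, linearFormProd, smul_eq_C_mul]

theorem steenrod_coeff_linearFormProd {m : ℕ} (hm : m < n) (k : ℕ) :
    steenrod p n (p ^ k)
        ((linearFormProd p (X : Fin n → MvPolynomial (Fin n) (ZMod p))).coeff (p ^ m)) =
      if k + 1 = m then
        -(linearFormProd p (X : Fin n → MvPolynomial (Fin n) (ZMod p))).coeff (p ^ (m - 1))
      else if k + 1 = n then
        (linearFormProd p (X : Fin n → MvPolynomial (Fin n) (ZMod p))).coeff (p ^ m) *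
          (linearFormProd p (X : Fin n → MvPolynomial (Fin n) (ZMod p))).coeff (p ^ (n - 1))
      else 0 := by
  have hp : 1 < p := (Fact.out : p.Prime).one_lt
  obtain ⟨N, rfl⟩ : ∃ N, n = N + 1 := ⟨n - 1, by omega⟩
  let S := MvPolynomial (Fin (N + 1)) (ZMod p)
  let f : Polynomial S := linearFormProd p X
  let l : Fin (N + 1) → Polynomial S := fun i => Polynomial.C (X i)
  have hf : linearFormProd p l = f.map Polynomial.C :=
    (map_linearFormProd (Polynomial.CAlgHom (R := ZMod p) (A := S)) X).symm
  have hg : linearFormProd p (fun i => l i + Polynomial.X * l i ^ p) =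
      f.map (Pt p (N + 1) : S →+* Polynomial S) := by
    rw [map_linearFormProd]
    congr 1
    funext i
    have hX : Pt p (N + 1) (X i) = Polynomial.C (X i) + Polynomial.C (X i ^ p) * Polynomial.X :=
      aeval_X _ i
    rw [hX, Polynomial.C_pow, mul_comm]
  have hgc : ∀ e, (linearFormProd p (fun i => l i + Polynomial.X * l i ^ p)).coeff e =
      Pt p (N + 1) (f.coeff e) := fun e => by rw [hg, Polynomial.coeff_map]; rfl
  have hfc : ∀ e, (linearFormProd p l).coeff e = Polynomial.C (f.coeff e) := fun e => by
    rw [hf, Polynomial.coeff_map]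
  have htop : f.coeff (p ^ (N + 1)) = 1 := coeff_linearFormProd_top _
  have := coeff_prime_pow_of_recursion hp (N := N) (a := fun m => f.coeff (p ^ m))
    (b := fun m => f.coeff (p ^ m) ^ p) (A := fun m => Pt p (N + 1) (f.coeff (p ^ m)))
    (H := ∏ v : Fin (N + 1) → ZMod p, (1 + Polynomial.X * (∑ j, v j • l j) ^ (p - 1)))
    (by
      have := coeff_linearFormProd_one (p := p) l Polynomial.X
      rw [hgc, hfc] at this
      simpa only [pow_zero] using this)
    (fun m hm => by
      have := coeff_linearFormProd_recursion (p := p) l Polynomial.X m (Nat.lt_succ_of_le hm)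
      rw [hgc, hgc, hfc, hfc] at this
      simpa only [Polynomial.C_pow] using this)
    htop (by simp [htop])
    (by
      refine (Polynomial.natDegree_prod_le _ _).trans
        ((Finset.sum_le_card_nsmul _ _ 1 fun v _ => ?_).trans (by simp [ZMod.card]))
      have h : ∑ j, v j • l j = Polynomial.C (∑ j, v j • X j : S) := by
        simp only [l, map_sum, Polynomial.smul_C]
      rw [h, ← Polynomial.C_pow]
      compute_degree)
    (Nat.lt_succ_iff.1 hm) k
  simpa [steenrod] using this

theorem steenrod_dickson {i : ℕ} (h1 : 1 ≤ i) (h2 : i ≤ n) (k : ℕ) :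
    steenrod p n (p ^ k) (dickson p n i) =
      if k + i + 1 = n ∧ i < n then dickson p n (i + 1)
      else if k + 1 = n then -(dickson p n i * dickson p n 1)
      else 0 := by
  have h : steenrod p n (p ^ k) (dickson p n i) = (-1) ^ i * steenrod p n (p ^ k)
      ((linearFormProd p (X : Fin n → MvPolynomial (Fin n) (ZMod p))).coeff (p ^ (n - i))) := by
    rw [dickson_eq_coeff_linearFormProd, steenrod, steenrod, map_mul, map_pow, map_neg, map_one,
      ← Polynomial.C_1, ← Polynomial.C_neg, ← Polynomial.C_pow, Polynomial.coeff_C_mul]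
  rw [h, steenrod_coeff_linearFormProd (by omega)]
  simp only [dickson_eq_coeff_linearFormProd]
  by_cases hk : k + 1 = n - i
  · rw [if_pos hk, if_pos (by omega), Nat.sub_sub]
    ring
  · rw [if_neg hk, if_neg (show ¬(k + i + 1 = n ∧ i < n) by omega)]
    split_ifs <;> ring

theorem steenrod_pow_char_pow (f : MvPolynomial (Fin n) (ZMod p)) (j e : ℕ) :
    steenrod p n e (f ^ p ^ j) =
      if p ^ j ∣ e then steenrod p n (e / p ^ j) f ^ p ^ j else 0 := by
  rw [steenrod, map_pow, ← Polynomial.map_iterateFrobenius_expand p, Polynomial.coeff_map,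
    Polynomial.coeff_expand (Nat.pow_pos (Fact.out : p.Prime).pos)]
  split_ifs <;> simp [iterateFrobenius_def, steenrod, (Fact.out : p.Prime).ne_zero]

end

/-- Action of `P^{p^k}` on `p^j`-th powers of Dickson invariants:
`P^{p^k}(d_{n,i}^{p^j}) = d_{n,i+1}^{p^j}` if `k = n+j-i-1` and `i < n`;
`P^{p^k}(d_{n,i}^{p^j}) = -d_{n,i}^{p^j} d_{n,1}^{p^j}` if `k = j+n-1`;
and `P^{p^k}(d_{n,i}^{p^j}) = 0` otherwise. -/
theorem steenrod_pow_dickson (p n : ℕ) [Fact p.Prime] (i j k : ℕ)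
    (h1 : 1 ≤ i) (h2 : i ≤ n) :
    steenrod p n (p ^ k) (dickson p n i ^ p ^ j) =
      if k + i + 1 = n + j ∧ i < n then dickson p n (i + 1) ^ p ^ j
      else if k + 1 = j + n then -(dickson p n i ^ p ^ j * dickson p n 1 ^ p ^ j)
      else 0 := by
  have hp : 1 < p := (Fact.out : p.Prime).one_lt
  rw [steenrod_pow_char_pow]
  rcases lt_or_ge k j with hkj | hkj
  · rw [if_neg fun h => hkj.not_ge ((Nat.pow_dvd_pow_iff_le_right hp).1 h),
      if_neg (by omega), if_neg (by omega)]
  · obtain ⟨k, rfl⟩ := Nat.exists_eq_add_of_le hkj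
    rw [if_pos (pow_dvd_pow p hkj), Nat.pow_div hkj (by omega), Nat.add_sub_cancel_left,
      steenrod_dickson h1 h2]
    by_cases h3 : k + i + 1 = n ∧ i < n
    · rw [if_pos h3, if_pos (by omega)]
    · rw [if_neg h3, if_neg (show ¬(j + k + i + 1 = n + j ∧ i < n) by omega)]
      by_cases h4 : k + 1 = n
      · rw [if_pos h4, if_pos (by omega), neg_pow, mul_pow, neg_one_pow_char_pow,
          neg_one_mul]
      · rw [if_neg h4, if_neg (by omega), zero_pow (pow_pos (by omega) _).ne']
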